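/- Let q be a prime power, m ≥ 1, n ≥ 1, and H a hyperplane in F_q^n with G = GL_n(F_q)_H. Then the Hilbert series of the G-invariants in S/(x_1^{q^m},...,x_n^{q^m}) equals ((1−t^{q^m})/(1−t^q))^{n−1} · ( (1−t^{q^m−1})/(1−t^{q−1}) + t^{q^m−1}·((1−t^q)/(1−t))^{n−1} ). -/

import Mathlib

open MvPolynomial Matrix

/-- The `m`-th Frobenius power of the irrelevant ideal, `(x_1^N, …, x_n^N)`. -/
noncomputable def frobIdeal (F : Type) [Field F] (n N : ℕ) : Ideal (MvPolynomial (Fin n) F) :=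
  Ideal.span (Set.range fun i : Fin n => (X i : MvPolynomial (Fin n) F) ^ N)

/-- The substitution action of `g ∈ GL_n(F)` on polynomials: `x_i ↦ Σ_j g_{ij} x_j`. -/
noncomputable def gSub {F : Type} [Field F] {n : ℕ} (g : GL (Fin n) F) :
    MvPolynomial (Fin n) F →ₐ[F] MvPolynomial (Fin n) F :=
  aeval fun i => ∑ j, C ((g : Matrix (Fin n) (Fin n) F) i j) * X j

/-- Polynomials `f` with `g·f ≡ f mod (x_1^N,…,x_n^N)` for all `g ∈ G`. -/
noncomputable def invLift {F : Type} [Field F] {n : ℕ} (G : Subgroup (GL (Fin n) F)) (N : ℕ) :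
    Submodule F (MvPolynomial (Fin n) F) :=
  ⨅ g ∈ G, Submodule.comap ((gSub g).toLinearMap - LinearMap.id)
    ((frobIdeal F n N).restrictScalars F)

/-- Dimension of the degree-`d` graded piece of the `G`-invariants in
`S/(x_1^N,…,x_n^N)`. -/
noncomputable def invPieceDim {F : Type} [Field F] {n : ℕ} (G : Subgroup (GL (Fin n) F))
    (N d : ℕ) : ℕ :=
  Module.finrank F ((homogeneousSubmodule (Fin n) F d ⊓ invLift G N).map
    (Ideal.Quotient.mkₐ F (frobIdeal F n N)).toLinearMap)

/-- Hilbert series of the `G`-invariants in `S/(x_1^N,…,x_n^N)` over `ℤ`. -/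
noncomputable def invHilb {F : Type} [Field F] {n : ℕ} (G : Subgroup (GL (Fin n) F))
    (N : ℕ) : PowerSeries ℤ :=
  PowerSeries.mk fun d => (invPieceDim G N d : ℤ)

/-- The polynomial `Y^q - Y Z^(q-1)`, fixed by all translations `Y ↦ Y + uZ`. -/
def dickson {A : Type*} [CommRing A] (q : ℕ) (y z : A) : A := y ^ q - y * z ^ (q - 1)

/-- The products `∏ (Y_i^q - Y_i Z^(q-1))^(a_i) · ∏ Y_i^(b_i) · Z^j`. -/
def mixedMonomial {ι A : Type*} [Fintype ι] [CommRing A] (q : ℕ) (Y : ι → A) (Z : A)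
    (a b : ι → ℕ) (j : ℕ) : A :=
  (∏ i, dickson q (Y i) Z ^ a i) * (∏ i, Y i ^ b i) * Z ^ j

/-- The exponents of the mixed monomials forming a basis of the truncated polynomial ring. -/
abbrev MixedIndex (ι : Type*) (M q N : ℕ) : Type _ := (ι → Fin M) × (ι → Fin q) × Fin N

/-- The degree of the mixed monomial with given exponents. -/
def mixedDegree {ι : Type*} [Fintype ι] {M q N : ℕ} (x : MixedIndex ι M q N) : ℕ :=
  q * ∑ i, (x.1 i : ℕ) + ∑ i, (x.2.1 i : ℕ) + x.2.2

/-- The mixed monomials with restricted exponents. -/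
def mixedFamily {ι A : Type*} [Fintype ι] [CommRing A] {M q N : ℕ} (Y : ι → A) (Z : A)
    (x : MixedIndex ι M q N) : A :=
  mixedMonomial q Y Z (fun i => x.1 i) (fun i => x.2.1 i) x.2.2

lemma prod_pow_add_single {ι A : Type*} [Fintype ι] [DecidableEq ι] [CommRing A]
    (f : ι → A) (b : ι → ℕ) (i : ι) (s : ℕ) :
    ∏ l, f l ^ (b + Pi.single i s : ι → ℕ) l = (∏ l, f l ^ b l) * f i ^ s := by
  simp only [Pi.add_apply, pow_add, Finset.prod_mul_distrib]
  simp [Pi.single_apply, pow_ite]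

lemma sum_add_single {ι : Type*} [Fintype ι] [DecidableEq ι] (b : ι → ℕ) (i : ι) (s : ℕ) :
    ∑ l, (b + Pi.single i s : ι → ℕ) l = (∑ l, b l) + s := by
  simp [Finset.sum_add_distrib, Finset.sum_pi_single']

lemma exists_eq_add_single {ι : Type*} [DecidableEq ι] {b : ι → ℕ} {i : ι} {s : ℕ}
    (h : s ≤ b i) : ∃ b' : ι → ℕ, b = b' + Pi.single i s := by
  refine ⟨b - Pi.single i s, ?_⟩
  ext l
  by_cases hl : l = i
  · subst hl; simp [h]
  · simp [hl]

section Frobenius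

variable {F A : Type*} [Field F] [Fintype F] [CommRing A] [Algebra F A]

variable (F A) in
lemma exists_algHom_pow_card (m : ℕ) :
    ∃ φ : A →ₐ[F] A, ∀ x, φ x = x ^ (Fintype.card F) ^ m := by
  refine ⟨FiniteField.frobeniusAlgHom F A ^ m, fun x => ?_⟩
  rw [AlgHom.coe_pow, FiniteField.coe_frobeniusAlgHom, pow_iterate]

variable {ι : Type*} [Fintype ι] [DecidableEq ι] {q m : ℕ} (hq : Fintype.card F = q)
include hq

lemma dickson_pow (y z : A) (m : ℕ) :
    dickson q y z ^ q ^ m = y ^ q ^ (m + 1) - y ^ q ^ m * z ^ ((q - 1) * q ^ m) := by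
  obtain ⟨φ, hφ⟩ := exists_algHom_pow_card F A m
  rw [hq] at hφ
  rw [← hφ, dickson, map_sub, map_mul, hφ, hφ, hφ, ← pow_mul, ← pow_mul, pow_succ']

lemma mixedMonomial_mem_span (Y : ι → A) (Z : A) (hY : ∀ i, Y i ^ q ^ (m + 1) = 0)
    (hZ : Z ^ q ^ (m + 1) = 0) (a b : ι → ℕ) (j d : ℕ)
    (hd : q * ∑ i, a i + ∑ i, b i + j = d) :
    mixedMonomial q Y Z a b j ∈ Submodule.span F
      (mixedFamily (M := q ^ m) (q := q) (N := q ^ (m + 1)) Y Z '' {x | mixedDegree x = d}) := by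
  have hq1 : 1 < q := hq ▸ Fintype.one_lt_card
  obtain ⟨s, hs⟩ : ∃ s, q ^ (m + 1) - j = s := ⟨_, rfl⟩
  induction s using Nat.strong_induction_on generalizing a b j with
  | _ s ihs =>
  obtain ⟨t, ht⟩ : ∃ t, ∑ i, b i = t := ⟨_, rfl⟩
  induction t using Nat.strong_induction_on generalizing a b j with
  | _ t iht =>
  by_cases hj : q ^ (m + 1) ≤ j
  · rw [mixedMonomial, pow_eq_zero_of_le hj hZ, mul_zero]
    exact zero_mem _
  push Not at hj
  by_cases hb : ∃ i, q ≤ b i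
  · obtain ⟨i, hi⟩ := hb
    obtain ⟨b, rfl⟩ := exists_eq_add_single hi
    have key : mixedMonomial q Y Z a (b + Pi.single i q) j =
        mixedMonomial q Y Z (a + Pi.single i 1) b j +
        mixedMonomial q Y Z a (b + Pi.single i 1) (j + (q - 1)) := by
      simp only [mixedMonomial, prod_pow_add_single, pow_add Z, dickson]
      ring
    rw [sum_add_single] at hd ht
    rw [key]
    refine add_mem (iht (∑ l, b l) (by omega) _ _ _ ?_ hs rfl)
      (ihs _ ?_ _ _ _ ?_ rfl)
    · rw [sum_add_single, mul_add]; omega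
    · omega
    · rw [sum_add_single]; omega
  push Not at hb
  by_cases ha : ∃ i, q ^ m ≤ a i
  · obtain ⟨i, hi⟩ := ha
    obtain ⟨a, rfl⟩ := exists_eq_add_single hi
    have hqm : 0 < q ^ m := by positivity
    have key : mixedMonomial q Y Z (a + Pi.single i (q ^ m)) b j =
        - mixedMonomial q Y Z a (b + Pi.single i (q ^ m)) (j + (q - 1) * q ^ m) := by
      simp only [mixedMonomial, prod_pow_add_single, pow_add Z, dickson_pow hq, hY]
      ring
    rw [key]
    have hpos : 0 < (q - 1) * q ^ m := Nat.mul_pos (by omega) hqm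
    refine neg_mem (ihs _ ?_ _ _ _ ?_ rfl)
    · omega
    · rw [sum_add_single] at hd ⊢
      have : (q - 1) * q ^ m + q ^ m = q * q ^ m := by
        obtain ⟨r, rfl⟩ : ∃ r, q = r + 1 := ⟨q - 1, by omega⟩
        simp; ring
      rw [mul_add] at hd
      omega
  push Not at ha
  exact Submodule.subset_span
    ⟨(fun i => ⟨a i, ha i⟩, fun i => ⟨b i, hb i⟩, ⟨j, hj⟩), by simpa [mixedDegree] using hd, rfl⟩

end Frobenius

section Invariants

variable {F A ι : Type*} [Field F] [Fintype F] [CommRing A] [Algebra F A] [Fintype ι]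
  [DecidableEq ι] {M N q : ℕ}

lemma dickson_translate (hq : Fintype.card F = q) (y z : A) (u c : F) (hc : c ≠ 0) :
    dickson q (y + u • z) (c • z) = dickson q y z := by
  obtain ⟨φ, hφ⟩ := exists_algHom_pow_card F A 1
  rw [hq, pow_one] at hφ
  have hq1 : 1 < q := hq ▸ Fintype.one_lt_card
  have hpow : c ^ (q - 1) = 1 := hq ▸ FiniteField.pow_card_sub_one_eq_one c hc
  have hz : z * z ^ (q - 1) = z ^ q := by rw [← pow_succ', Nat.sub_add_cancel hq1.le]
  simp only [dickson]
  rw [← hφ, map_add, map_smul, hφ, hφ, smul_pow, hpow, one_smul, add_mul, smul_mul_assoc, hz]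
  ring

omit [DecidableEq ι] in
lemma map_mixedMonomial_zero (hq : Fintype.card F = q) {Y : ι → A} {Z : A} (τ : A →ₐ[F] A)
    {c : F} (hc : c ≠ 0) {u : ι → F} (hZ : τ Z = c • Z) (hY : ∀ i, τ (Y i) = Y i + u i • Z)
    (a : ι → ℕ) (j : ℕ) (hj : q - 1 ∣ j) :
    τ (mixedMonomial q Y Z a 0 j) = mixedMonomial q Y Z a 0 j := by
  have hw : ∀ i, τ (dickson q (Y i) Z) = dickson q (Y i) Z := fun i => by
    have := dickson_translate hq (Y i) Z (u i) c hc
    rw [← hY, ← hZ] at this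
    conv_rhs => rw [← this]
    simp [dickson]
  obtain ⟨s, rfl⟩ := hj
  have hpow : c ^ (q - 1) = 1 := hq ▸ FiniteField.pow_card_sub_one_eq_one c hc
  simp [mixedMonomial, hw, hZ, smul_pow, pow_mul, hpow]

lemma map_mixedMonomial_top (hq : Fintype.card F = q) {Y : ι → A} {Z : A} (τ : A →ₐ[F] A)
    {c : F} (hc : c ≠ 0) {u : ι → F} (hZ : τ Z = c • Z) (hY : ∀ i, τ (Y i) = Y i + u i • Z)
    (a b : ι → ℕ) (j : ℕ) (hj : q - 1 ∣ j) (hZj : Z ^ (j + 1) = 0) :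
    τ (mixedMonomial q Y Z a b j) = mixedMonomial q Y Z a b j := by
  have h0 := map_mixedMonomial_zero hq τ hc hZ hY a j hj
  have hsplit : mixedMonomial q Y Z a b j = mixedMonomial q Y Z a 0 j * ∏ i, Y i ^ b i := by
    simp [mixedMonomial]; ring
  have hstep : ∀ (P : A) (i : ι), Z ^ j * (P * (Y i + u i • Z)) = Z ^ j * (P * Y i) := by
    intro P i
    rw [mul_add, mul_add, mul_smul_comm, mul_smul_comm, mul_left_comm _ P Z, ← pow_succ, hZj]
    simp
  have hprod : Z ^ j * ∏ i, (Y i + u i • Z) ^ b i = Z ^ j * ∏ i, Y i ^ b i := by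
    have hpow : ∀ (i : ι) (r : ℕ) (P Q : A), Z ^ j * P = Z ^ j * Q →
        Z ^ j * (P * (Y i + u i • Z) ^ r) = Z ^ j * (Q * Y i ^ r) := by
      intro i r P Q hPQ
      induction r with
      | zero => simpa using hPQ
      | succ r ih =>
        rw [pow_succ, pow_succ, ← mul_assoc P, hstep, ← mul_assoc, ih]; ring
    induction (Finset.univ : Finset ι) using Finset.induction_on with
    | empty => simp
    | insert i s hi ih =>
      rw [Finset.prod_insert hi, Finset.prod_insert hi, mul_comm _ (∏ x ∈ s, _),
        mul_comm _ (∏ x ∈ s, _)]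
      exact hpow i _ _ _ ih
  rw [hsplit, map_mul, h0, map_prod]
  simp only [map_pow, hY]
  have h1 : mixedMonomial q Y Z a 0 j = (∏ i, dickson q (Y i) Z ^ a i) * Z ^ j := by
    simp [mixedMonomial]
  rw [h1, mul_assoc, hprod, mul_assoc]

omit [DecidableEq ι] in
lemma map_mixedMonomial_torus (hq : Fintype.card F = q) {Y : ι → A} {Z : A} (τ : A →ₐ[F] A)
    {c : F} (hc : c ≠ 0) (hZ : τ Z = c • Z) (hY : ∀ i, τ (Y i) = Y i)
    (a b : ι → ℕ) (j : ℕ) :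
    τ (mixedMonomial q Y Z a b j) = c ^ j • mixedMonomial q Y Z a b j := by
  have h0 := map_mixedMonomial_zero hq τ hc (u := 0) hZ (by simpa using hY) a 0 (dvd_zero _)
  have hsplit : mixedMonomial q Y Z a b j =
      mixedMonomial q Y Z a 0 0 * (∏ i, Y i ^ b i) * Z ^ j := by
    simp [mixedMonomial]
  rw [hsplit, map_mul, map_mul, h0, map_prod]
  simp [hY, hZ, smul_pow]

lemma map_mixedMonomial_translation (hq : Fintype.card F = q) {Y : ι → A} {Z : A}
    (τ : A →ₐ[F] A) {c : F} {i : ι} (hZ : τ Z = Z) (hYi : τ (Y i) = Y i + c • Z)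
    (hY : ∀ l ≠ i, τ (Y l) = Y l) (a b : ι → ℕ) (hb : b i = 0) (s j : ℕ) :
    τ (mixedMonomial q Y Z a (b + Pi.single i s) j) = ∑ r ∈ Finset.range (s + 1),
      (c ^ (s - r) * (s.choose r : F)) •
        mixedMonomial q Y Z a (b + Pi.single i r) (j + (s - r)) := by
  have h0 := map_mixedMonomial_zero hq τ (one_ne_zero) (u := Pi.single i c)
    (by simpa using hZ) (fun l => by
      by_cases hl : l = i
      · subst hl; simpa using hYi
      · simpa [hl] using hY l hl) a 0 (dvd_zero _)
  have hsplit : ∀ r j, mixedMonomial q Y Z a (b + Pi.single i r) j =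
      mixedMonomial q Y Z a 0 0 * (∏ i, Y i ^ b i) * Y i ^ r * Z ^ j := by
    intro r j
    simp only [mixedMonomial, prod_pow_add_single]
    simp; ring
  have hprod : τ (∏ l, Y l ^ b l) = ∏ l, Y l ^ b l := by
    rw [map_prod]
    refine Finset.prod_congr rfl fun l _ => ?_
    by_cases hl : l = i
    · subst hl; simp [hb]
    · rw [map_pow, hY l hl]
  simp only [hsplit, map_mul, h0, hprod, map_pow, hZ, hYi]
  rw [add_pow, Finset.mul_sum, Finset.sum_mul]
  refine Finset.sum_congr rfl fun r _ => ?_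
  rw [smul_pow, Algebra.smul_def, Algebra.smul_def, map_mul, map_natCast, pow_add]
  ring

lemma sum_eq_zero_of_sum_mul_pow_const (hq : Fintype.card F = q) {κ : Type*} [Fintype κ]
    (c : κ → F) (s : κ → ℕ) (hs : ∀ x, s x < q) (C₀ : F)
    (h : ∀ γ : F, ∑ x, c x * γ ^ s x = C₀) (k : ℕ) (hk : 0 < k) :
    ∑ x, (if s x = k then c x else 0) = 0 := by
  have hq1 : 1 < q := hq ▸ Fintype.one_lt_card
  let P : Polynomial F :=
    ∑ x, Polynomial.C (c x) * Polynomial.X ^ s x - Polynomial.C C₀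
  have hdeg : P.natDegree < q := by
    refine lt_of_le_of_lt (b := q - 1) ?_ (by omega)
    refine (Polynomial.natDegree_sub_C).trans_le ?_
    refine Polynomial.natDegree_sum_le_of_forall_le _ _ fun x _ => ?_
    exact (Polynomial.natDegree_C_mul_X_pow_le _ _).trans (by have := hs x; omega)
  have hP : P = 0 :=
    Polynomial.eq_zero_of_natDegree_lt_card_of_eval_eq_zero P (f := (id : F → F))
      Function.injective_id (fun γ => by simp [P, Polynomial.eval_finsetSum, h]) (hq ▸ hdeg)
  have := congrArg (fun Q : Polynomial F => Q.coeff k) hP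
  simpa [P, Polynomial.coeff_C, hk.ne', Polynomial.finsetSum_coeff, eq_comm] using this

variable {Y : ι → A} {Z : A} (B : Module.Basis (MixedIndex ι M q N) F A)
  (hB : ∀ x, B x = mixedFamily Y Z x)
include hB

omit [Fintype F] [DecidableEq ι] in
lemma repr_mixedMonomial (hZ : Z ^ N = 0) (a : ι → Fin M) (b : ι → ℕ) (hb : ∀ i, b i < q)
    (j : ℕ) (x : MixedIndex ι M q N) :
    B.repr (mixedMonomial q Y Z (fun i => a i) b j) x =
      if a = x.1 ∧ (∀ i, b i = x.2.1 i) ∧ j = x.2.2 then 1 else 0 := by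
  by_cases hj : j < N
  · have : mixedMonomial q Y Z (fun i => (a i : ℕ)) b j = B (a, fun i => ⟨b i, hb i⟩, ⟨j, hj⟩) := by
      rw [hB]; rfl
    rw [this, Module.Basis.repr_self, Finsupp.single_apply]
    congr 1
    simp [Prod.ext_iff, funext_iff, Fin.ext_iff]
  · have : ¬ j = x.2.2 := by have := x.2.2.2; omega
    rw [mixedMonomial, pow_eq_zero_of_le (not_lt.1 hj) hZ]
    simp [this]

lemma repr_map_translation (hq : Fintype.card F = q) (hZN : Z ^ N = 0) (τ : A →ₐ[F] A) {c : F}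
    {i : ι} (hZ : τ Z = Z) (hYi : τ (Y i) = Y i + c • Z) (hY : ∀ l ≠ i, τ (Y l) = Y l)
    (x y : MixedIndex ι M q N) (hx : (x.2.1 i : ℕ) = 0) :
    B.repr (τ (B y)) x = if y.1 = x.1 ∧ (∀ l ≠ i, y.2.1 l = x.2.1 l) ∧
      (y.2.2 + y.2.1 i : ℕ) = x.2.2 then c ^ (y.2.1 i : ℕ) else 0 := by
  have hq1 : 1 < q := hq ▸ Fintype.one_lt_card
  let b : ι → ℕ := Function.update (fun l => (y.2.1 l : ℕ)) i 0
  have hb : b i = 0 := by simp [b]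
  have hbl : ∀ l ≠ i, b l = y.2.1 l := fun l hl => by simp [b, hl]
  have hy : (fun l => (y.2.1 l : ℕ)) = b + Pi.single i (y.2.1 i : ℕ) := by
    ext l
    by_cases hl : l = i
    · subst hl; simp [hb]
    · simp [hl, hbl l hl]
  rw [hB, mixedFamily, hy, map_mixedMonomial_translation hq τ hZ hYi hY _ _ hb]
  simp only [map_sum, map_smul, Finsupp.coe_finsetSum, Finset.sum_apply, Finsupp.smul_apply]
  rw [Finset.sum_eq_single_of_mem 0 (by simp)]
  · rw [repr_mixedMonomial B hB hZN]
    · have : (∀ l, (b + Pi.single i 0 : ι → ℕ) l = x.2.1 l) ↔ ∀ l ≠ i, y.2.1 l = x.2.1 l := by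
        constructor
        · intro h l hl
          have := h l
          simp [hbl l hl] at this
          exact Fin.ext this
        · intro h l
          by_cases hl : l = i
          · subst hl; simp [hb, hx]
          · simp [hbl l hl, h l hl]
      simp only [this]
      simp
    · intro l
      by_cases hl : l = i
      · subst hl; simp [hb]; omega
      · simp [hbl l hl]
  · intro r hr hr0
    rw [Finset.mem_range] at hr
    rw [repr_mixedMonomial B hB hZN, if_neg, smul_zero]
    · rintro ⟨-, h, -⟩
      have := h i
      simp [hb, hx] at this
      exact hr0 this
    · intro l
      by_cases hl : l = i
      · subst hl; simp [hb]; have := (y.2.1 l).2; omega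
      · simp [hbl l hl, Pi.single_eq_of_ne hl]

lemma dvd_of_torus_fixed (hq : Fintype.card F = q) (f : A)
    (hT : ∀ c : F, c ≠ 0 → ∃ τ : A →ₐ[F] A, τ Z = c • Z ∧ (∀ i, τ (Y i) = Y i) ∧ τ f = f)
    (x : MixedIndex ι M q N) (hx : B.repr f x ≠ 0) : q - 1 ∣ (x.2.2 : ℕ) := by
  classical
  obtain ⟨g, hg⟩ := IsCyclic.exists_generator (α := Fˣ)
  have hord : orderOf g = q - 1 := by
    rw [orderOf_eq_card_of_forall_mem_zpowers hg, Nat.card_eq_fintype_card, Fintype.card_units, hq]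
  obtain ⟨τ, hZ, hY, hf⟩ := hT g g.ne_zero
  have key : B.repr (τ f) x = (g : F) ^ (x.2.2 : ℕ) * B.repr f x := by
    conv_lhs => rw [← B.sum_repr f]
    simp only [map_sum, map_smul, Finsupp.coe_finsetSum, Finset.sum_apply, Finsupp.smul_apply]
    have : ∀ y, τ (B y) = (g : F) ^ (y.2.2 : ℕ) • B y := fun y => by
      rw [hB]; exact map_mixedMonomial_torus hq τ g.ne_zero hZ hY _ _ _
    simp only [this, map_smul, Finsupp.smul_apply, Module.Basis.repr_self, smul_eq_mul]
    rw [Finset.sum_eq_single x]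
    · simp [mul_comm]
    · intro y _ hy; simp [hy]
    · simp
  rw [hf] at key
  rw [← hord, orderOf_dvd_iff_pow_eq_one, ← Units.val_inj]
  simpa using (mul_right_cancel₀ hx ((one_mul _).trans key)).symm

lemma repr_eq_zero_of_translation_fixed (hq : Fintype.card F = q) (hZN : Z ^ N = 0) (f : A) (i : ι)
    (hU : ∀ c : F, ∃ τ : A →ₐ[F] A, τ Z = Z ∧ τ (Y i) = Y i + c • Z ∧
      (∀ l ≠ i, τ (Y l) = Y l) ∧ τ f = f)
    (x : MixedIndex ι M q N) (hi : 0 < (x.2.1 i : ℕ))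
    (hj : (x.2.2 + x.2.1 i : ℕ) < N) : B.repr f x = 0 := by
  have hq1 : 1 < q := hq ▸ Fintype.one_lt_card
  let x₀ : MixedIndex ι M q N :=
    (x.1, Function.update x.2.1 i ⟨0, by omega⟩, ⟨x.2.2 + x.2.1 i, hj⟩)
  let p : MixedIndex ι M q N → Prop := fun y =>
    y.1 = x.1 ∧ (∀ l ≠ i, y.2.1 l = x.2.1 l) ∧ (y.2.2 + y.2.1 i : ℕ) = x.2.2 + x.2.1 i
  classical
  have h := sum_eq_zero_of_sum_mul_pow_const hq
    (fun y => if p y then B.repr f y else 0) (fun y => (y.2.1 i : ℕ)) (fun y => (y.2.1 i).2)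
    (B.repr f x₀) (fun γ => ?_) (x.2.1 i) hi
  · rw [Finset.sum_eq_single x] at h
    · simpa [p] using h
    · intro y _ hy
      split_ifs with h1 h2
      · refine absurd ?_ hy
        obtain ⟨ha, hb, hc⟩ := h2
        refine Prod.ext ha (Prod.ext ?_ (Fin.ext (by omega)))
        ext l
        by_cases hl : l = i
        · subst hl; exact h1
        · rw [hb l hl]
      · rfl
      · rfl
    · simp
  · obtain ⟨τ, hZ, hYi, hY, hf⟩ := hU γ
    conv_rhs => rw [← hf, ← B.sum_repr f]
    simp only [map_sum, map_smul, Finsupp.coe_finsetSum, Finset.sum_apply, Finsupp.smul_apply]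
    refine Finset.sum_congr rfl fun y _ => ?_
    rw [repr_map_translation B hB hq hZN τ hZ hYi hY x₀ y (by simp [x₀])]
    have hp : (y.1 = x₀.1 ∧ (∀ l ≠ i, y.2.1 l = x₀.2.1 l) ∧
        (y.2.2 + y.2.1 i : ℕ) = x₀.2.2) ↔ p y := by
      simp only [x₀, p]
      refine and_congr_right fun _ => and_congr_left fun _ => forall₂_congr fun l hl => ?_
      simp [hl]
    simp only [hp]
    split_ifs <;> simp

end Invariants

section Counting

open Finset

lemma sum_fin_fun_pow {R : Type*} [CommRing R] (k M : ℕ) (t : R) :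
    (1 - t) ^ k * ∑ a : Fin k → Fin M, t ^ (∑ i, (a i : ℕ)) = (1 - t ^ M) ^ k := by
  have : ∑ a : Fin k → Fin M, t ^ (∑ i, (a i : ℕ)) = (∑ c ∈ range M, t ^ c) ^ k := by
    rw [Finset.sum_range, ← Fin.prod_const, Finset.prod_univ_sum, Fintype.piFinset_univ]
    simp [Finset.prod_pow_eq_pow_sum]
  rw [this, ← mul_pow, mul_neg_geom_sum]

lemma sum_range_dvd_pow {R : Type*} [CommRing R] (r L : ℕ) (hr : 0 < r) (t : R) :
    ∑ j ∈ range (r * L), (if r ∣ j then t ^ j else 0) = ∑ l ∈ range L, (t ^ r) ^ l := by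
  induction L with
  | zero => simp
  | succ L ih =>
    rw [mul_add, mul_one, Finset.sum_range_add, ih, Finset.sum_range_succ, ← pow_mul]
    congr 1
    rw [Finset.sum_eq_single_of_mem 0 (by simpa using hr)]
    · simp
    · intro i hi hi0
      rw [if_neg]
      rw [(Nat.dvd_add_right (dvd_mul_right r L))]
      exact Nat.not_dvd_of_pos_of_lt (Nat.pos_of_ne_zero hi0) (mem_range.1 hi)

/-- The exponents of the mixed monomials invariant under the pointwise stabilizer. -/
def IsInvIndex {ι : Type*} {M q N : ℕ} (x : MixedIndex ι M q N) : Prop :=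
  q - 1 ∣ (x.2.2 : ℕ) ∧ ((∀ i, (x.2.1 i : ℕ) = 0) ∨ (x.2.2 : ℕ) + 1 = N)

open Classical in
lemma sum_isInvIndex {R : Type*} [CommRing R] (k M q L : ℕ) (hq : 1 < q) (t : R) :
    (∑ x : MixedIndex (Fin k) M q ((q - 1) * L + 1),
        if IsInvIndex x then t ^ mixedDegree x else 0) =
      (∑ a : Fin k → Fin M, (t ^ q) ^ (∑ i, (a i : ℕ))) *
        (∑ l ∈ range L, (t ^ (q - 1)) ^ l +
          t ^ ((q - 1) * L) * ∑ e : Fin k → Fin q, t ^ (∑ i, (e i : ℕ))) := by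
  rw [Fintype.sum_prod_type, Finset.sum_mul]
  refine Finset.sum_congr rfl fun a _ => ?_
  rw [Fintype.sum_prod_type]
  have h0 : ∀ e : Fin k → Fin q, (∀ i, (e i : ℕ) = 0) ↔ e = fun _ => ⟨0, by omega⟩ := fun e => by
    simp [funext_iff, Fin.ext_iff]
  simp only [Fin.sum_univ_castSucc, Finset.sum_add_distrib]
  rw [mul_add]
  congr 1
  · rw [Finset.sum_comm, ← sum_range_dvd_pow _ _ (by omega), Finset.sum_range, Finset.mul_sum]
    refine Finset.sum_congr rfl fun j _ => ?_
    have hj : ¬ (j : ℕ) = (q - 1) * L := j.2.ne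
    simp only [IsInvIndex, h0, Fin.val_castSucc, Nat.add_right_cancel_iff, hj, or_false]
    rw [Finset.sum_eq_single (fun _ => ⟨0, by omega⟩)]
    · simp [mixedDegree, pow_add, pow_mul]
    · intro e _ he; simp [he]
    · simp
  · rw [Finset.mul_sum, Finset.mul_sum]
    refine Finset.sum_congr rfl fun e _ => ?_
    simp [IsInvIndex, mixedDegree, pow_add, pow_mul]
    ring

end Counting

section Hilbert

variable {F A ι : Type*} [Field F] [Fintype F] [CommRing A] [Algebra F A] [Fintype ι]
  [DecidableEq ι] {M N q : ℕ}

open Classical in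
lemma finrank_inf_fixed {Y : ι → A} {Z : A} (B : Module.Basis (MixedIndex ι M q N) F A)
    (hB : ∀ x, B x = mixedFamily Y Z x) (hq : Fintype.card F = q) (hZN : Z ^ N = 0)
    (hN : q - 1 ∣ N - 1) (d : ℕ) (V : Submodule F A)
    (hV : V = Submodule.span F (B '' {x | mixedDegree x = d}))
    (T : Set (A →ₐ[F] A))
    (hT : ∀ τ ∈ T, ∃ c : F, c ≠ 0 ∧ τ Z = c • Z ∧ ∃ u : ι → F, ∀ i, τ (Y i) = Y i + u i • Z)
    (htor : ∀ c : F, c ≠ 0 → ∃ τ ∈ T, τ Z = c • Z ∧ ∀ i, τ (Y i) = Y i)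
    (htrans : ∀ i, ∀ c : F, ∃ τ ∈ T, τ Z = Z ∧ τ (Y i) = Y i + c • Z ∧ ∀ l ≠ i, τ (Y l) = Y l)
    (W : Submodule F A) (hW : ∀ f, f ∈ W ↔ ∀ τ ∈ T, τ f = f) :
    Module.finrank F (V ⊓ W : Submodule F A) =
      (Finset.univ.filter fun x : MixedIndex ι M q N => mixedDegree x = d ∧ IsInvIndex x).card := by
  have hq1 : 1 < q := hq ▸ Fintype.one_lt_card
  have key : (V ⊓ W : Submodule F A) =
      Submodule.span F (B '' {x | mixedDegree x = d ∧ IsInvIndex x}) := by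
    apply le_antisymm
    · rintro f ⟨hfV, hfW⟩
      rw [SetLike.mem_coe, hV, Module.Basis.mem_span_image] at hfV
      rw [SetLike.mem_coe, hW] at hfW
      rw [Module.Basis.mem_span_image]
      intro x hx
      have hx0 : B.repr f x ≠ 0 := by simpa using hx
      have hdvd : q - 1 ∣ (x.2.2 : ℕ) := dvd_of_torus_fixed B hB hq f (fun c hc => by
        obtain ⟨τ, hτ, h1, h2⟩ := htor c hc
        exact ⟨τ, h1, h2, hfW τ hτ⟩) x hx0
      refine ⟨hfV hx, hdvd, ?_⟩
      by_contra! hcon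
      obtain ⟨⟨i, hi⟩, hne⟩ := hcon
      refine hx0 (repr_eq_zero_of_translation_fixed B hB hq hZN f i (fun c => ?_) x
        (Nat.pos_of_ne_zero hi) ?_)
      · obtain ⟨τ, hτ, h1, h2, h3⟩ := htrans i c
        exact ⟨τ, h1, h2, h3, hfW τ hτ⟩
      · have h1 := (x.2.1 i).2
        have h2 := x.2.2.2
        obtain ⟨s, hs⟩ := hdvd
        obtain ⟨t, ht⟩ := hN
        have hst : s < t := lt_of_mul_lt_mul_left (a := q - 1) (by omega) (Nat.zero_le _)
        have := Nat.mul_le_mul_left (q - 1) (Nat.succ_le_of_lt hst)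
        rw [Nat.mul_succ] at this
        omega
    · rw [Submodule.span_le]
      rintro _ ⟨x, ⟨hxd, hdvd, hx⟩, rfl⟩
      refine ⟨hV ▸ Submodule.subset_span ⟨x, hxd, rfl⟩, ?_⟩
      rw [SetLike.mem_coe, hW]
      intro τ hτ
      obtain ⟨c, hc, hZ, u, hY⟩ := hT τ hτ
      rw [hB, mixedFamily]
      rcases hx with hx | hx
      · have : (fun i => (x.2.1 i : ℕ)) = 0 := funext hx
        rw [this]
        exact map_mixedMonomial_zero hq τ hc hZ hY _ _ hdvd
      · exact map_mixedMonomial_top hq τ hc hZ hY _ _ _ hdvd (by rw [hx, hZN])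
  rw [key, ← Finset.coe_filter_univ, ← Finset.coe_image, finrank_span_finset_eq_card,
    Finset.card_image_of_injective _ B.injective]
  rw [Finset.coe_image]
  exact (B.linearIndependent.linearIndepOn _).id_image

end Hilbert

section Stabilizer

variable {F : Type} [Field F] {k : ℕ}

lemma exists_adapted_coordinates (H : Submodule F (Fin (k + 1) → F))
    (hH : Module.finrank F H = k) :
    ∃ h : GL (Fin (k + 1)) F,
      ∀ v, v ∈ H ↔ ((h : Matrix (Fin (k + 1)) (Fin (k + 1)) F) *ᵥ v) 0 = 0 := by
  obtain ⟨C, hC⟩ := H.exists_isCompl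
  have hCdim : Module.finrank F C = 1 := by
    have := Submodule.finrank_add_eq_of_isCompl hC
    simp only [Module.finrank_fin_fun] at this
    omega
  let eH : H ≃ₗ[F] (Fin k → F) := LinearEquiv.ofFinrankEq _ _ (by simpa using hH)
  let eC : C ≃ₗ[F] F := LinearEquiv.ofFinrankEq _ _ (by simpa using hCdim)
  let e : (Fin (k + 1) → F) ≃ₗ[F] (Fin (k + 1) → F) :=
    (C.prodEquivOfIsCompl H hC.symm).symm ≪≫ₗ (eC.prodCongr eH) ≪≫ₗ
      Fin.consLinearEquiv F (fun _ => F)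
  have he : ∀ v, v ∈ H ↔ e v 0 = 0 := fun v => by
    have : e v 0 = eC ((C.prodEquivOfIsCompl H hC.symm).symm v).1 := rfl
    rw [this, LinearEquiv.map_eq_zero_iff, Submodule.prodEquivOfIsCompl_symm_apply_fst_eq_zero]
  refine ⟨Matrix.GeneralLinearGroup.toLin.symm
    ((LinearMap.GeneralLinearGroup.generalLinearEquiv F _).symm e), fun v => ?_⟩
  rw [he v]
  have : ((Matrix.GeneralLinearGroup.toLin.symm
    ((LinearMap.GeneralLinearGroup.generalLinearEquiv F _).symm e) : GL (Fin (k + 1)) F) :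
      Matrix (Fin (k + 1)) (Fin (k + 1)) F) = LinearMap.toMatrix' e.toLinearMap := rfl
  rw [this, LinearMap.toMatrix'_mulVec]
  rfl

variable {H : Submodule F (Fin (k + 1) → F)} {h : GL (Fin (k + 1)) F}
  (hh : ∀ v, v ∈ H ↔ ((h : Matrix (Fin (k + 1)) (Fin (k + 1)) F) *ᵥ v) 0 = 0)
include hh

lemma exists_row_of_stabilizes (g : GL (Fin (k + 1)) F)
    (hg : ∀ v ∈ H, (g : Matrix (Fin (k + 1)) (Fin (k + 1)) F) *ᵥ v = v) :
    ∃ u : Fin (k + 1) → F, 1 + u 0 ≠ 0 ∧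
      ∀ i j, (h * g : GL (Fin (k + 1)) F) i j = h i j + u i * h 0 j := by
  set hM : Matrix (Fin (k + 1)) (Fin (k + 1)) F := h.val
  set gM : Matrix (Fin (k + 1)) (Fin (k + 1)) F := g.val
  obtain ⟨w, hw⟩ : ∃ w, hM *ᵥ w = Pi.single 0 1 :=
    ⟨((h⁻¹ : GL (Fin (k + 1)) F) : Matrix (Fin (k + 1)) (Fin (k + 1)) F) *ᵥ Pi.single 0 1, by
      rw [Matrix.mulVec_mulVec, ← Units.val_mul, mul_inv_cancel, Units.val_one, Matrix.one_mulVec]⟩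
  have key : ∀ v i, (hM *ᵥ (gM *ᵥ v)) i =
      (hM *ᵥ v) i + (hM *ᵥ (gM *ᵥ w - w)) i * (hM *ᵥ v) 0 := by
    intro v i
    have hmem : v - (hM *ᵥ v) 0 • w ∈ H := by
      rw [hh, Matrix.mulVec_sub, Matrix.mulVec_smul, hw]; simp
    have h1 := hg _ hmem
    rw [Matrix.mulVec_sub, Matrix.mulVec_smul, sub_eq_iff_eq_add] at h1
    rw [h1]
    simp only [Matrix.mulVec_sub, Matrix.mulVec_add, Matrix.mulVec_smul, Pi.add_apply,
      Pi.sub_apply, Pi.smul_apply, smul_eq_mul]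
    ring
  refine ⟨hM *ᵥ (gM *ᵥ w - w), fun h0 => ?_, fun i j => ?_⟩
  · have h1 := key w 0
    rw [hw] at h1
    simp only [Pi.single_eq_same, mul_one] at h1
    rw [h0] at h1
    have h2 := hg _ ((hh _).2 h1)
    have hinv : ∀ v, (g⁻¹ : GL (Fin (k + 1)) F).val *ᵥ (gM *ᵥ v) = v := fun v => by
      rw [Matrix.mulVec_mulVec, ← Units.val_mul, inv_mul_cancel, Units.val_one, Matrix.one_mulVec]
    have h3 : gM *ᵥ w = w := by
      simpa only [hinv] using congrArg ((g⁻¹ : GL (Fin (k + 1)) F).val *ᵥ ·) h2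
    rw [h3, hw] at h1
    simp at h1
  · have := key (Pi.single j 1) i
    rw [Matrix.mulVec_mulVec] at this
    simpa using this

lemma exists_stabilizes_of_row (u : Fin (k + 1) → F) (hu : 1 + u 0 ≠ 0) :
    ∃ g : GL (Fin (k + 1)) F,
      (∀ v ∈ H, (g : Matrix (Fin (k + 1)) (Fin (k + 1)) F) *ᵥ v = v) ∧
      ∀ i j, (h * g : GL (Fin (k + 1)) F) i j = h i j + u i * h 0 j := by
  let P : Matrix (Fin (k + 1)) (Fin (k + 1)) F :=
    1 + Matrix.replicateCol Unit u *
      Matrix.replicateRow Unit (Pi.single 0 1 : Fin (k + 1) → F)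
  have hP : P.det ≠ 0 := by
    rw [Matrix.det_one_add_replicateCol_mul_replicateRow]
    simpa using hu
  have hPij : ∀ i j, P i j = (1 : Matrix _ _ F) i j + u i * (Pi.single 0 1 : Fin (k + 1) → F) j :=
    fun i j => by simp [P, Matrix.mul_apply]
  have hPv : ∀ v, P *ᵥ v = v + v 0 • u := fun v => by
    ext i
    simp [Matrix.mulVec, dotProduct, hPij, add_mul, Finset.sum_add_distrib, Matrix.one_apply,
      Pi.single_apply]
    ring
  let p : GL (Fin (k + 1)) F := Matrix.GeneralLinearGroup.mkOfDetNeZero P hP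
  have hp : (p : Matrix (Fin (k + 1)) (Fin (k + 1)) F) = P := rfl
  refine ⟨h⁻¹ * p * h, fun v hv => ?_, fun i j => ?_⟩
  · rw [Units.val_mul, Units.val_mul, ← Matrix.mulVec_mulVec, ← Matrix.mulVec_mulVec, hp, hPv,
      (hh v).1 hv, zero_smul, add_zero, Matrix.mulVec_mulVec, ← Units.val_mul]
    simp
  · rw [← mul_assoc, ← mul_assoc, mul_inv_cancel, one_mul]
    simp [Matrix.mul_apply, hp, hPij, add_mul, Finset.sum_add_distrib, Matrix.one_apply,
      Pi.single_apply]

end Stabilizer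

section TruncatedPolynomial

variable {F : Type} [Field F] {n : ℕ}

lemma gSub_X (g : GL (Fin n) F) (i : Fin n) :
    gSub g (X i) = ∑ j, C ((g : Matrix (Fin n) (Fin n) F) i j) * X j := by
  simp [gSub]

lemma gSub_gSub (g h : GL (Fin n) F) (p : MvPolynomial (Fin n) F) :
    gSub g (gSub h p) = gSub (h * g) p := by
  rw [← AlgHom.comp_apply]
  congr 1
  refine MvPolynomial.algHom_ext fun i => ?_
  have hC : ∀ c : F, gSub g (C c) = C c := fun c => AlgHom.commutes (gSub g) c
  rw [AlgHom.comp_apply, gSub_X, gSub_X]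
  simp only [map_sum, map_mul, hC, gSub_X, Finset.mul_sum, Units.val_mul, Matrix.mul_apply,
    Finset.sum_mul]
  rw [Finset.sum_comm]
  simp only [mul_assoc]

lemma gSub_one (p : MvPolynomial (Fin n) F) : gSub (1 : GL (Fin n) F) p = p := by
  have : gSub (1 : GL (Fin n) F) = AlgHom.id F _ := by
    refine MvPolynomial.algHom_ext fun i => ?_
    simp [gSub_X, Matrix.one_apply]
  rw [this]; rfl

lemma isHomogeneous_gSub_X (g : GL (Fin n) F) (i : Fin n) : (gSub g (X i)).IsHomogeneous 1 := by
  rw [gSub_X]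
  exact IsHomogeneous.sum _ _ _ fun j _ => isHomogeneous_C_mul_X _ _

lemma isHomogeneous_gSub (g : GL (Fin n) F) {p : MvPolynomial (Fin n) F} {d : ℕ}
    (hp : p.IsHomogeneous d) : (gSub g p).IsHomogeneous d := by
  rw [← one_mul d]
  exact hp.aeval _ fun i => gSub_X g i ▸ isHomogeneous_gSub_X g i

lemma gSub_X_pow_mem [Fintype F] (g : GL (Fin n) F) (i : Fin n) (m : ℕ) :
    gSub g (X i) ^ (Fintype.card F) ^ m ∈ frobIdeal F n ((Fintype.card F) ^ m) := by
  obtain ⟨φ, hφ⟩ := exists_algHom_pow_card F (MvPolynomial (Fin n) F) m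
  rw [← hφ, gSub_X, map_sum]
  refine sum_mem fun j _ => ?_
  rw [map_mul, hφ (X j)]
  exact Ideal.mul_mem_left _ _ (Ideal.subset_span ⟨j, rfl⟩)

lemma frobIdeal_le_comap [Fintype F] (g : GL (Fin n) F) (m : ℕ) :
    frobIdeal F n ((Fintype.card F) ^ m) ≤
      (frobIdeal F n ((Fintype.card F) ^ m)).comap (gSub g) := by
  conv_lhs => rw [frobIdeal]
  rw [Ideal.span_le]
  rintro _ ⟨i, rfl⟩
  simpa using gSub_X_pow_mem g i m

lemma linearIndependent_truncated_monomials (N : ℕ) :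
    LinearIndependent F fun v : Fin n → Fin N =>
      Ideal.Quotient.mkₐ F (frobIdeal F n N)
        (monomial (Finsupp.equivFunOnFinite.symm fun i => (v i : ℕ)) 1) := by
  classical
  rw [Fintype.linearIndependent_iff]
  intro c hc v
  let E : (Fin n → Fin N) → Fin n →₀ ℕ := fun v => Finsupp.equivFunOnFinite.symm fun i => (v i : ℕ)
  have hE : Function.Injective E := fun v w hvw => by
    ext i
    exact DFunLike.congr_fun hvw i
  have hmem : ∑ v, c v • monomial (E v) (1 : F) ∈ frobIdeal F n N := by
    rw [← Ideal.Quotient.eq_zero_iff_mem, ← Ideal.Quotient.mkₐ_eq_mk F, map_sum]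
    simpa only [map_smul] using hc
  have hspan : frobIdeal F n N = Ideal.span
      ((fun s => monomial s (1 : F)) '' Set.range fun i : Fin n => Finsupp.single i N) := by
    rw [frobIdeal, ← Set.range_comp]
    simp [Function.comp_def, X_pow_eq_monomial]
  rw [hspan, mem_ideal_span_monomial_image] at hmem
  by_contra hcv
  obtain ⟨_, ⟨i, rfl⟩, hi⟩ := hmem (E v) (by
    rw [mem_support_iff, coeff_sum, Finset.sum_eq_single v]
    · simpa using hcv
    · intro w _ hw
      simp [coeff_monomial, hE.ne hw]
    · simp)
  have := hi i
  simp only [Finsupp.single_eq_same, E, Finsupp.equivFunOnFinite_symm_apply_apply] at this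
  exact absurd (v i).2 (not_lt.2 this)

lemma isHomogeneous_mixedMonomial {ι : Type*} [Fintype ι] {q : ℕ} (hq : 1 < q)
    {Y : ι → MvPolynomial (Fin n) F} {Z : MvPolynomial (Fin n) F}
    (hY : ∀ i, (Y i).IsHomogeneous 1) (hZ : Z.IsHomogeneous 1) (a b : ι → ℕ) (j : ℕ) :
    (mixedMonomial q Y Z a b j).IsHomogeneous (q * ∑ i, a i + ∑ i, b i + j) := by
  have hw : ∀ i, (dickson q (Y i) Z).IsHomogeneous q := fun i => by
    refine IsHomogeneous.sub (by simpa using (hY i).pow q) ?_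
    have := (hY i).mul (hZ.pow (q - 1))
    rwa [one_mul, Nat.add_sub_cancel' hq.le] at this
  refine ((IsHomogeneous.mul ?_ ?_).mul (by simpa using hZ.pow j))
  · rw [Finset.mul_sum]
    exact IsHomogeneous.prod _ _ _ fun i _ => (hw i).pow _
  · exact IsHomogeneous.prod _ _ _ fun i _ => by simpa using (hY i).pow (b i)

lemma map_mixedMonomial {ι A A' : Type*} [Fintype ι] [CommRing A] [CommRing A'] (φ : A →+* A')
    (q : ℕ) (Y : ι → A) (Z : A) (a b : ι → ℕ) (j : ℕ) :
    φ (mixedMonomial q Y Z a b j) = mixedMonomial q (fun i => φ (Y i)) (φ Z) a b j := by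
  simp [mixedMonomial, dickson]

end TruncatedPolynomial

section HilbertSeries

variable {F : Type} [Field F] [Fintype F] {k m q : ℕ}

/-- The truncated polynomial ring `S / (x_1^(q^m), …, x_n^(q^m))` with `q = |F|`. -/
abbrev TruncPoly (F : Type) [Field F] (n N : ℕ) : Type := MvPolynomial (Fin n) F ⧸ frobIdeal F n N

/-- The image in the truncated polynomial ring of the `i`-th linear form of a coordinate system. -/
noncomputable def truncForm {n : ℕ} (N : ℕ) (h : GL (Fin n) F) (i : Fin n) : TruncPoly F n N :=
  Ideal.Quotient.mkₐ F (frobIdeal F n N) (gSub h (X i))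

/-- The action of a matrix on the truncated polynomial ring. -/
noncomputable def truncAct {n : ℕ} (hq : Fintype.card F = q) (m : ℕ) (g : GL (Fin n) F) :
    TruncPoly F n (q ^ m) →ₐ[F] TruncPoly F n (q ^ m) :=
  Ideal.quotientMapₐ _ (gSub g) (hq ▸ frobIdeal_le_comap g m)

omit [Fintype F] in
lemma truncForm_eq {n : ℕ} (N : ℕ) (h : GL (Fin n) F) (i : Fin n) :
    truncForm N h i =
      ∑ j, h i j • Ideal.Quotient.mkₐ F (frobIdeal F n N) (X j) := by
  simp only [truncForm, gSub_X, map_sum, C_mul', map_smul]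

lemma truncAct_truncForm {n : ℕ} (hq : Fintype.card F = q) (m : ℕ) (g h : GL (Fin n) F)
    (i : Fin n) : truncAct hq m g (truncForm (q ^ m) h i) = truncForm (q ^ m) (h * g) i := by
  rw [truncForm, truncForm, ← gSub_gSub]
  rfl

lemma truncForm_pow {n : ℕ} (hq : Fintype.card F = q) (m : ℕ) (h : GL (Fin n) F) (i : Fin n) :
    truncForm (q ^ m) h i ^ q ^ m = 0 := by
  subst hq
  rw [truncForm, ← map_pow, Ideal.Quotient.mkₐ_eq_mk, Ideal.Quotient.eq_zero_iff_mem]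
  exact gSub_X_pow_mem h i m

lemma mk_gSub_mem_span (hq : Fintype.card F = q) (h : GL (Fin (k + 1)) F)
    (p : MvPolynomial (Fin (k + 1)) F) (S : Set ℕ) (hp : ∀ s ∈ p.support, s.degree ∈ S) :
    Ideal.Quotient.mkₐ F (frobIdeal F (k + 1) (q ^ (m + 1))) (gSub h p) ∈
      Submodule.span F (mixedFamily (M := q ^ m) (q := q) (N := q ^ (m + 1))
        (fun i : Fin k => truncForm (q ^ (m + 1)) h i.succ) (truncForm (q ^ (m + 1)) h 0) ''
          {x | mixedDegree x ∈ S}) := by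
  rw [p.as_sum, map_sum, map_sum]
  refine sum_mem fun s hs => ?_
  have hmon : Ideal.Quotient.mkₐ F (frobIdeal F (k + 1) (q ^ (m + 1)))
      (gSub h (monomial s (p.coeff s))) =
      p.coeff s • mixedMonomial q (fun i : Fin k => truncForm (q ^ (m + 1)) h i.succ)
        (truncForm (q ^ (m + 1)) h 0) 0 (fun i => s i.succ) (s 0) := by
    rw [monomial_eq, C_mul', map_smul, map_smul, Finsupp.prod_fintype _ _ (by simp),
      Fin.prod_univ_succ]
    simp [mixedMonomial, truncForm, mul_comm]
  rw [hmon]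
  have hdeg : q * ∑ i : Fin k, (0 : Fin k → ℕ) i + ∑ i : Fin k, s i.succ + s 0 = s.degree := by
    rw [Finsupp.degree_eq_sum, Fin.sum_univ_succ]
    simp [add_comm]
  have hmem := mixedMonomial_mem_span (m := m) hq
    (fun i : Fin k => truncForm (q ^ (m + 1)) h i.succ) (truncForm (q ^ (m + 1)) h 0)
    (fun i => truncForm_pow hq _ h _) (truncForm_pow hq _ h _) 0 (fun i => s i.succ) (s 0) _ hdeg
  refine Submodule.smul_mem _ _ (Submodule.span_mono (Set.image_mono fun x hx => ?_) hmem)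
  rw [Set.mem_ofPred_eq] at hx ⊢
  exact hx ▸ hp s hs

lemma exists_mixedBasis (hq : Fintype.card F = q) (h : GL (Fin (k + 1)) F) :
    ∃ B : Module.Basis (MixedIndex (Fin k) (q ^ m) q (q ^ (m + 1))) F
        (TruncPoly F (k + 1) (q ^ (m + 1))),
      ∀ x, B x = mixedFamily (fun i : Fin k => truncForm (q ^ (m + 1)) h i.succ)
        (truncForm (q ^ (m + 1)) h 0) x := by
  let f : MixedIndex (Fin k) (q ^ m) q (q ^ (m + 1)) → TruncPoly F (k + 1) (q ^ (m + 1)) :=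
    mixedFamily (fun i : Fin k => truncForm (q ^ (m + 1)) h i.succ) (truncForm (q ^ (m + 1)) h 0)
  have hspan : ⊤ ≤ Submodule.span F (Set.range f) := by
    rintro y -
    obtain ⟨p, rfl⟩ := Ideal.Quotient.mkₐ_surjective F _ y
    have hp : p = gSub h (gSub h⁻¹ p) := by rw [gSub_gSub, inv_mul_cancel, gSub_one]
    rw [hp]
    exact Submodule.span_mono (Set.image_subset_range _ _)
      (mk_gSub_mem_span hq h (gSub h⁻¹ p) Set.univ (by simp))
  have : Module.Finite F (TruncPoly F (k + 1) (q ^ (m + 1))) :=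
    ⟨⟨(Set.finite_range f).toFinset, by simpa using top_le_iff.1 hspan⟩⟩
  have hcard : Fintype.card (MixedIndex (Fin k) (q ^ m) q (q ^ (m + 1))) =
      (q ^ (m + 1)) ^ (k + 1) := by
    simp only [Fintype.card_prod, Fintype.card_fun, Fintype.card_fin]
    ring
  have hrank : Fintype.card (MixedIndex (Fin k) (q ^ m) q (q ^ (m + 1))) =
      Module.finrank F (TruncPoly F (k + 1) (q ^ (m + 1))) := by
    apply le_antisymm
    · have := (linearIndependent_truncated_monomials (F := F) (n := k + 1)
        (q ^ (m + 1))).fintype_card_le_finrank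
      rw [hcard]
      simpa using this
    · have := finrank_range_le_card (R := F) f
      rwa [Set.finrank, top_le_iff.1 hspan, finrank_top] at this
  exact ⟨basisOfTopLeSpanOfCardEqFinrank f hspan hrank, fun x => by simp [f]⟩

omit [Fintype F] in
lemma map_homogeneousSubmodule_ge (hq : 1 < q) (h : GL (Fin (k + 1)) F) (N d : ℕ)
    (x : MixedIndex (Fin k) (q ^ m) q (q ^ (m + 1))) (hx : mixedDegree x = d) :
    mixedFamily (fun i : Fin k => truncForm N h i.succ) (truncForm N h 0) x ∈
      (homogeneousSubmodule (Fin (k + 1)) F d).map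
        (Ideal.Quotient.mkₐ F (frobIdeal F (k + 1) N)).toLinearMap := by
  refine ⟨mixedFamily (fun i : Fin k => gSub h (X i.succ)) (gSub h (X 0)) x, ?_,
    map_mixedMonomial (Ideal.Quotient.mk (frobIdeal F (k + 1) N)) q
      (fun i : Fin k => gSub h (X i.succ)) (gSub h (X 0)) _ _ _⟩
  rw [SetLike.mem_coe, mem_homogeneousSubmodule, ← hx]
  exact isHomogeneous_mixedMonomial hq (fun i => isHomogeneous_gSub_X h _)
    (isHomogeneous_gSub_X h _) _ _ _

lemma map_homogeneousSubmodule (hq : Fintype.card F = q) (h : GL (Fin (k + 1)) F) (d : ℕ) :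
    (homogeneousSubmodule (Fin (k + 1)) F d).map
        (Ideal.Quotient.mkₐ F (frobIdeal F (k + 1) (q ^ (m + 1)))).toLinearMap =
      Submodule.span F (mixedFamily (M := q ^ m) (q := q) (N := q ^ (m + 1))
        (fun i : Fin k => truncForm (q ^ (m + 1)) h i.succ) (truncForm (q ^ (m + 1)) h 0) ''
          {x | mixedDegree x = d}) := by
  have hq1 : 1 < q := hq ▸ Fintype.one_lt_card
  apply le_antisymm
  · rintro _ ⟨p, hp, rfl⟩
    have hp' : p = gSub h (gSub h⁻¹ p) := by rw [gSub_gSub, inv_mul_cancel, gSub_one]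
    rw [hp']
    refine mk_gSub_mem_span hq h (gSub h⁻¹ p) {d} fun s hs => ?_
    by_contra hne
    exact mem_support_iff.1 hs ((isHomogeneous_gSub h⁻¹ hp).coeff_eq_zero hne)
  · rw [Submodule.span_le]
    rintro _ ⟨x, hx, rfl⟩
    exact map_homogeneousSubmodule_ge hq1 h _ d x hx

open Classical in
lemma invPieceDim_eq (hq : Fintype.card F = q) (H : Submodule F (Fin (k + 1) → F))
    (hH : Module.finrank F H = k) (G : Subgroup (GL (Fin (k + 1)) F))
    (hG : ∀ g : GL (Fin (k + 1)) F, g ∈ G ↔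
      ∀ v ∈ H, Matrix.mulVec (g : Matrix (Fin (k + 1)) (Fin (k + 1)) F) v = v) (d : ℕ) :
    invPieceDim G (q ^ (m + 1)) d =
      (Finset.univ.filter fun x : MixedIndex (Fin k) (q ^ m) q (q ^ (m + 1)) =>
        mixedDegree x = d ∧ IsInvIndex x).card := by
  obtain ⟨h, hh⟩ := exists_adapted_coordinates H hH
  obtain ⟨B, hB⟩ := exists_mixedBasis (m := m) hq h
  let W : Submodule F (TruncPoly F (k + 1) (q ^ (m + 1))) :=
    ⨅ g ∈ G, LinearMap.ker ((truncAct hq (m + 1) g).toLinearMap - LinearMap.id)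
  have hW : ∀ f, f ∈ W ↔ ∀ τ ∈ truncAct hq (m + 1) '' (G : Set (GL (Fin (k + 1)) F)), τ f = f := by
    intro f
    simp [W, Submodule.mem_iInf, sub_eq_zero]
  have hlift : invLift G (q ^ (m + 1)) =
      W.comap (Ideal.Quotient.mkₐ F (frobIdeal F (k + 1) (q ^ (m + 1)))).toLinearMap := by
    ext p
    simp only [invLift, W, Submodule.mem_iInf, Submodule.mem_comap, LinearMap.mem_ker,
      LinearMap.sub_apply, LinearMap.id_apply, Submodule.restrictScalars_mem,
      AlgHom.toLinearMap_apply]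
    refine forall₂_congr fun g _ => ?_
    rw [← Ideal.Quotient.eq_zero_iff_mem, map_sub]
    rfl
  have hrow : ∀ (g : GL (Fin (k + 1)) F) (u : Fin (k + 1) → F),
      (∀ i j, (h * g : GL (Fin (k + 1)) F) i j = h i j + u i * h 0 j) → ∀ i,
      truncAct hq (m + 1) g (truncForm (q ^ (m + 1)) h i) =
        truncForm (q ^ (m + 1)) h i + u i • truncForm (q ^ (m + 1)) h 0 := by
    intro g u hu i
    rw [truncAct_truncForm, truncForm_eq, truncForm_eq, truncForm_eq]
    simp only [hu, add_smul, Finset.sum_add_distrib, Finset.smul_sum, mul_smul]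
  have hdvd : q - 1 ∣ q ^ (m + 1) - 1 := by simpa using Nat.sub_dvd_pow_sub_pow q 1 (m + 1)
  rw [invPieceDim, hlift, ← Submodule.map_inf_eq_map_inf_comap]
  refine finrank_inf_fixed B hB hq (truncForm_pow hq _ h 0) hdvd d _ ?_ _ ?_ ?_ ?_ W hW
  · rw [map_homogeneousSubmodule hq h d, funext hB]
  · rintro _ ⟨g, hg, rfl⟩
    obtain ⟨u, hu0, hu⟩ := exists_row_of_stabilizes hh g ((hG g).1 hg)
    exact ⟨1 + u 0, hu0, by rw [hrow g u hu, add_smul, one_smul], fun i => u i.succ,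
      fun i => hrow g u hu _⟩
  · intro c hc
    obtain ⟨g, hg, hu⟩ := exists_stabilizes_of_row hh (Pi.single 0 (c - 1)) (by simpa using hc)
    refine ⟨_, ⟨g, (hG g).2 hg, rfl⟩, ?_, fun i => ?_⟩
    · rw [hrow g _ hu, Pi.single_eq_same, sub_smul, one_smul]; abel
    · rw [hrow g _ hu]; simp
  · intro i c
    obtain ⟨g, hg, hu⟩ := exists_stabilizes_of_row hh (Pi.single i.succ c) (by simp)
    refine ⟨_, ⟨g, (hG g).2 hg, rfl⟩, ?_, ?_, fun l hl => ?_⟩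
    · rw [hrow g _ hu]; simp
    · rw [hrow g _ hu]; simp
    · rw [hrow g _ hu, Pi.single_eq_of_ne (by simpa using hl)]; simp

open Classical in
lemma invHilb_eq_sum (hq : Fintype.card F = q) (H : Submodule F (Fin (k + 1) → F))
    (hH : Module.finrank F H = k) (G : Subgroup (GL (Fin (k + 1)) F))
    (hG : ∀ g : GL (Fin (k + 1)) F, g ∈ G ↔
      ∀ v ∈ H, Matrix.mulVec (g : Matrix (Fin (k + 1)) (Fin (k + 1)) F) v = v) :
    invHilb G (q ^ (m + 1)) =
      ∑ x : MixedIndex (Fin k) (q ^ m) q (q ^ (m + 1)),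
        if IsInvIndex x then (PowerSeries.X : PowerSeries ℤ) ^ mixedDegree x else 0 := by
  ext d
  rw [invHilb, PowerSeries.coeff_mk, invPieceDim_eq hq H hH G hG, map_sum, Finset.card_filter,
    Nat.cast_sum]
  refine Finset.sum_congr rfl fun x _ => ?_
  by_cases hx : IsInvIndex x <;>
    simp [hx, PowerSeries.coeff_X_pow, eq_comm (a := d)]

end HilbertSeries

/-- For a hyperplane `H` in `F_q^n` and `G = GL_n(F_q)_H` its pointwise stabilizer,
`Hilb((S/𝔪^{[q^m]})^G, t) = ((1−t^{q^m})/(1−t^q))^{n−1} ·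
( (1−t^{q^m−1})/(1−t^{q−1}) + t^{q^m−1}·((1−t^q)/(1−t))^{n−1} )`,
stated with denominators cleared in `ℤ⟦t⟧`. -/
theorem stmt_10 (q n m : ℕ) (F : Type) [Field F] [Fintype F] (hq : Fintype.card F = q)
    (hm : 1 ≤ m) (hn : 1 ≤ n)
    (H : Submodule F (Fin n → F)) (hH : Module.finrank F H = n - 1)
    (G : Subgroup (GL (Fin n) F))
    (hG : ∀ g : GL (Fin n) F, g ∈ G ↔
      ∀ v ∈ H, Matrix.mulVec (g : Matrix (Fin n) (Fin n) F) v = v) :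
    invHilb G (q ^ m) * (1 - PowerSeries.X ^ q) ^ (n - 1) * (1 - PowerSeries.X ^ (q - 1))
        * (1 - PowerSeries.X) ^ (n - 1)
      = (1 - PowerSeries.X ^ q ^ m) ^ (n - 1)
          * ((1 - PowerSeries.X ^ (q ^ m - 1)) * (1 - PowerSeries.X) ^ (n - 1)
            + PowerSeries.X ^ (q ^ m - 1) * (1 - PowerSeries.X ^ q) ^ (n - 1)
              * (1 - PowerSeries.X ^ (q - 1))) := by
  obtain ⟨k, rfl⟩ : ∃ k, n = k + 1 := ⟨n - 1, by omega⟩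
  obtain ⟨m, rfl⟩ : ∃ m', m = m' + 1 := ⟨m - 1, by omega⟩
  have hq1 : 1 < q := hq ▸ Fintype.one_lt_card
  obtain ⟨L, hL⟩ : q - 1 ∣ q ^ (m + 1) - 1 := by
    simpa using Nat.sub_dvd_pow_sub_pow q 1 (m + 1)
  have hN : q ^ (m + 1) = (q - 1) * L + 1 := by
    have : 0 < q ^ (m + 1) := by positivity
    omega
  rw [Nat.add_sub_cancel] at hH ⊢
  rw [invHilb_eq_sum hq H hH G hG, hL, hN, sum_isInvIndex k _ q L hq1]
  have ha := sum_fin_fun_pow k (q ^ m) ((PowerSeries.X : PowerSeries ℤ) ^ q)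
  have he := sum_fin_fun_pow k q (PowerSeries.X : PowerSeries ℤ)
  have hl := mul_neg_geom_sum ((PowerSeries.X : PowerSeries ℤ) ^ (q - 1)) L
  rw [← pow_mul, ← pow_succ', hN] at ha
  rw [← pow_mul] at hl
  rw [← ha, ← hl, ← he]
  ring
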